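/- arXiv:1808.04148 — 3 statements merged into one kernel-verified Lean document; each statement's English description precedes it below -/
import Mathlib

section
/- There exists a finite simple graph that admits a grounded segment representation but admits no grounded {L,J}-representation. -/
/-- The grounded L-shape with anchor `(a, 0)`, depth `h` and width `w`:
the union of the vertical segment from `(a, 0)` to `(a, -h)` and the
horizontal segment from `(a, -h)` to `(a + w, -h)`. -/
def LShape (a h w : ℝ) : Set (ℝ × ℝ) :=
  segment ℝ ((a, 0) : ℝ × ℝ) ((a, -h) : ℝ × ℝ) ∪
    segment ℝ ((a, -h) : ℝ × ℝ) ((a + w, -h) : ℝ × ℝ)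

/-- A grounded L-representation of a simple graph `G`. -/
structure GroundedLRep {V : Type} (G : SimpleGraph V) where
  a : V → ℝ
  ht : V → ℝ
  wd : V → ℝ
  ht_pos : ∀ v, 0 < ht v
  wd_pos : ∀ v, 0 < wd v
  a_inj : Function.Injective a
  ht_inj : Function.Injective ht
  endpoint_off : ∀ u v, u ≠ v →
    ((a v + wd v, -ht v) : ℝ × ℝ) ∉ LShape (a u) (ht u) (wd u)
  adj_iff : ∀ u v, u ≠ v →
    (G.Adj u v ↔ (LShape (a u) (ht u) (wd u) ∩ LShape (a v) (ht v) (wd v)).Nonempty)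

/-- The grounded J-shape with anchor `(a, 0)`, depth `h` and width `w`. -/
def JShape (a h w : ℝ) : Set (ℝ × ℝ) :=
  segment ℝ ((a, 0) : ℝ × ℝ) ((a, -h) : ℝ × ℝ) ∪
    segment ℝ ((a - w, -h) : ℝ × ℝ) ((a, -h) : ℝ × ℝ)

/-- The shape of a vertex in a grounded {L,J}-representation:
an L-shape if `isL = true`, a J-shape otherwise. -/
def LJShape (isL : Bool) (a h w : ℝ) : Set (ℝ × ℝ) :=
  if isL then LShape a h w else JShape a h w

/-- The horizontal endpoint of an L-shape or a J-shape. -/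
def LJEnd (isL : Bool) (a h w : ℝ) : ℝ × ℝ :=
  if isL then (a + w, -h) else (a - w, -h)

/-- A grounded {L,J}-representation of a simple graph `G`. -/
structure GroundedLJRep {V : Type} (G : SimpleGraph V) where
  a : V → ℝ
  ht : V → ℝ
  wd : V → ℝ
  isL : V → Bool
  ht_pos : ∀ v, 0 < ht v
  wd_pos : ∀ v, 0 < wd v
  a_inj : Function.Injective a
  ht_inj : Function.Injective ht
  endpoint_off : ∀ u v, u ≠ v →
    LJEnd (isL v) (a v) (ht v) (wd v) ∉ LJShape (isL u) (a u) (ht u) (wd u)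
  adj_iff : ∀ u v, u ≠ v →
    (G.Adj u v ↔
      (LJShape (isL u) (a u) (ht u) (wd u) ∩ LJShape (isL v) (a v) (ht v) (wd v)).Nonempty)

/-- The grounded segment from `(a, 0)` to `(b, -c)`. -/
def GSeg (a b c : ℝ) : Set (ℝ × ℝ) :=
  segment ℝ ((a, 0) : ℝ × ℝ) ((b, -c) : ℝ × ℝ)

/-- A grounded segment representation of a simple graph `G`. -/
structure GroundedSegRep {V : Type} (G : SimpleGraph V) where
  a : V → ℝ
  b : V → ℝ
  c : V → ℝ
  c_pos : ∀ v, 0 < c v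
  a_inj : Function.Injective a
  inter_finite : ∀ u v, u ≠ v → (GSeg (a u) (b u) (c u) ∩ GSeg (a v) (b v) (c v)).Finite
  endpoints_off : ∀ u v, u ≠ v →
    ((a v, 0) : ℝ × ℝ) ∉ GSeg (a u) (b u) (c u) ∧
    ((b v, -c v) : ℝ × ℝ) ∉ GSeg (a u) (b u) (c u)
  adj_iff : ∀ u v, u ≠ v →
    (G.Adj u v ↔ (GSeg (a u) (b u) (c u) ∩ GSeg (a v) (b v) (c v)).Nonempty)

/-- The points of the vertical part and of the horizontal part of an L- or J-shape. -/
theorem mem_LJShape_iff {isL : Bool} {a h w : ℝ} (hh : 0 < h) (hw : 0 < w) (p : ℝ × ℝ) :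
    p ∈ LJShape isL a h w ↔
      (p.1 = a ∧ -h ≤ p.2 ∧ p.2 ≤ 0) ∨
        (p.2 = -h ∧ if isL then a ≤ p.1 ∧ p.1 ≤ a + w else a - w ≤ p.1 ∧ p.1 ≤ a) := by
  obtain ⟨x, y⟩ := p
  have hv : segment ℝ ((a, 0) : ℝ × ℝ) ((a, -h) : ℝ × ℝ) = Prod.mk a '' Set.Icc (-h) 0 := by
    rw [segment_symm, ← Prod.image_mk_segment_right, segment_eq_Icc (by linarith)]
  have hr (b c : ℝ) (hbc : b ≤ c) : segment ℝ ((b, -h) : ℝ × ℝ) ((c, -h) : ℝ × ℝ) =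
      (fun z => (z, -h)) '' Set.Icc b c := by
    rw [← Prod.image_mk_segment_left, segment_eq_Icc hbc]
  cases isL
  · simp only [LJShape, JShape, hv, hr (a - w) a (by linarith)]
    simp [and_comm, eq_comm]
  · simp only [LJShape, LShape, hv, hr a (a + w) (by linarith)]
    simp [and_comm, eq_comm]

namespace GroundedLJRep

variable {V : Type} {G : SimpleGraph V} (R : GroundedLJRep G)

/-- The abscissae of the horizontal part of the shape of `v`. -/
def span (v : V) : Set ℝ :=
  if R.isL v then Set.Icc (R.a v) (R.a v + R.wd v) else Set.Icc (R.a v - R.wd v) (R.a v)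

/-- A shape meets a deeper one iff its horizontal part reaches the anchor line of the latter. -/
theorem adj_iff_mem_span {u v : V} (h : R.ht u < R.ht v) : G.Adj u v ↔ R.a v ∈ R.span u := by
  have huv : u ≠ v := by rintro rfl; exact lt_irrefl _ h
  have hu := R.ht_pos u
  have hne : R.a u ≠ R.a v := fun e => huv (R.a_inj e)
  rw [R.adj_iff u v huv]
  constructor
  · rintro ⟨p, hpu, hpv⟩
    rw [mem_LJShape_iff (R.ht_pos _) (R.wd_pos _)] at hpu hpv
    unfold span
    rcases hpu with ⟨h1, h2, h3⟩ | ⟨h1, h2⟩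
    · rcases hpv with ⟨h4, h5, h6⟩ | ⟨h4, h5⟩
      · exact absurd (h1.symm.trans h4) hne
      · linarith
    · rcases hpv with ⟨h4, h5, h6⟩ | ⟨h4, h5⟩
      · rw [h4] at h2
        split_ifs at h2 ⊢ <;> exact h2
      · linarith
  · intro hs
    refine ⟨(R.a v, -R.ht u), ?_, ?_⟩ <;> rw [mem_LJShape_iff (R.ht_pos _) (R.wd_pos _)]
    · right
      unfold span at hs
      refine ⟨rfl, ?_⟩
      split_ifs at hs ⊢ <;> exact hs
    · left
      exact ⟨rfl, by simpa using h.le, by simpa using hu.le⟩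

end GroundedLJRep

/-- `x` does not lie between `s` and `t`. -/
def OutsideChord {V : Type} (f : V → ℝ) (s t x : V) : Prop :=
  f s < f x ↔ f t < f x

/-- `x` and `y` lie on the same side of the chord `st`, when the real line is seen as a circle
punctured at infinity: the chords `st` and `xy` do not cross. -/
def SameSide {V : Type} (f : V → ℝ) (s t x y : V) : Prop :=
  OutsideChord f s t x ↔ OutsideChord f s t y

namespace SameSide

variable {V : Type} {f : V → ℝ} {s t x y : V}

theorem swap (h : SameSide f s t x y) : SameSide f t s x y := by
  unfold SameSide OutsideChord at *
  tauto

theorem symm (h : SameSide f s t x y) : SameSide f s t y x :=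
  Iff.symm h

theorem trans {z : V} (h : SameSide f s t x y) (h' : SameSide f s t y z) : SameSide f s t x z :=
  Iff.trans h h'

theorem comm (hf : Function.Injective f) (hsx : s ≠ x) (hsy : s ≠ y) (htx : t ≠ x) (hty : t ≠ y)
    (h : SameSide f s t x y) : SameSide f x y s t := by
  have h1 := hf.ne hsx
  have h2 := hf.ne hsy
  have h3 := hf.ne htx
  have h4 := hf.ne hty
  unfold SameSide OutsideChord at *
  grind

/-- Of the three ways to join four points on a circle by two chords, at least one has a crossing. -/
theorem not_sameSide (hf : Function.Injective f) (hd : [s, t, x, y].Nodup)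
    (h : SameSide f s t x y) (h' : SameSide f s x t y) : ¬ SameSide f x t s y := by
  have hd := hd.map hf
  unfold SameSide OutsideChord at *
  grind

/-- Of the three ways to join four points on a circle by two chords, at most one has a crossing. -/
theorem of_not_sameSide (hf : Function.Injective f) (hd : [s, t, x, y].Nodup)
    (h : ¬ SameSide f s t x y) : SameSide f x s y t := by
  have hd := hd.map hf
  unfold SameSide OutsideChord at *
  grind

theorem of_isChain {l : List V} (h : (x :: l).IsChain (SameSide f s t)) :
    SameSide f s t x ((x :: l).getLast (List.cons_ne_nil x l)) := by
  induction l generalizing x with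
  | nil => exact Iff.rfl
  | cons y l ih =>
    rw [List.isChain_cons_cons] at h
    rw [List.getLast_cons (List.cons_ne_nil y l)]
    exact h.1.trans (ih h.2)

end SameSide

namespace GroundedLJRep

variable {V : Type} {G : SimpleGraph V} (R : GroundedLJRep G)

/-- A vertex between `u` and a deeper neighbour of `u` is shallower than `u` or adjacent to it. -/
theorem outsideChord_of_not_adj {u v x : V} (huv : G.Adj u v) (hx : u ≠ x) (hvx : v ≠ x)
    (hux : ¬ G.Adj u x) (hv : R.ht u < R.ht v) (h : R.ht u < R.ht x) :
    OutsideChord R.a u v x := by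
  rw [R.adj_iff_mem_span hv] at huv
  rw [R.adj_iff_mem_span h] at hux
  have h1 := R.a_inj.ne hx
  have h2 := R.a_inj.ne hvx
  unfold OutsideChord
  unfold span at huv hux
  split_ifs at huv hux <;> simp only [Set.mem_Icc] at huv hux <;> grind

/-- The deeper neighbours of a vertex lie on one side of it. -/
theorem lt_iff_lt_of_adj {u v w : V} (huv : G.Adj u v) (huw : G.Adj u w)
    (hv : R.ht u < R.ht v) (hw : R.ht u < R.ht w) : R.a u < R.a v ↔ R.a u < R.a w := by
  have h1 := R.a_inj.ne huv.ne
  have h2 := R.a_inj.ne huw.ne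
  rw [R.adj_iff_mem_span hv] at huv
  rw [R.adj_iff_mem_span hw] at huw
  unfold span at huv huw
  split_ifs at huv huw <;> simp only [Set.mem_Icc] at huv huw <;> grind

theorem sameSide_of_le {u v x y : V} (huv : G.Adj u v)
    (hux : u ≠ x ∧ ¬ G.Adj u x) (huy : u ≠ y ∧ ¬ G.Adj u y)
    (hvx : v ≠ x) (hvy : v ≠ y)
    (hv : R.ht u ≤ R.ht v) (hx : R.ht u ≤ R.ht x) (hy : R.ht u ≤ R.ht y) :
    SameSide R.a u v x y := by
  have hv := hv.lt_of_ne (R.ht_inj.ne huv.ne)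
  have hx := hx.lt_of_ne (R.ht_inj.ne hux.1)
  have hy := hy.lt_of_ne (R.ht_inj.ne huy.1)
  exact iff_of_true (R.outsideChord_of_not_adj huv hux.1 hvx hux.2 hv hx)
    (R.outsideChord_of_not_adj huv huy.1 hvy huy.2 hv hy)

/-- Two disjoint edges inducing no further edge do not cross. -/
theorem sameSide_of_adj {u v x y : V} (huv : G.Adj u v) (hxy : G.Adj x y)
    (hux : u ≠ x ∧ ¬ G.Adj u x) (huy : u ≠ y ∧ ¬ G.Adj u y)
    (hvx : v ≠ x ∧ ¬ G.Adj v x) (hvy : v ≠ y ∧ ¬ G.Adj v y) : SameSide R.a u v x y := by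
  have flip {p q : V} (h : p ≠ q ∧ ¬ G.Adj p q) : q ≠ p ∧ ¬ G.Adj q p :=
    ⟨h.1.symm, fun e => h.2 e.symm⟩
  rcases le_total (R.ht u) (R.ht v) with h1 | h1 <;>
  rcases le_total (R.ht x) (R.ht y) with h2 | h2
  · rcases le_total (R.ht u) (R.ht x) with h3 | h3
    · exact R.sameSide_of_le huv hux huy hvx.1 hvy.1 h1 h3 (h3.trans h2)
    · refine SameSide.comm R.a_inj hux.1.symm hvx.1.symm huy.1.symm hvy.1.symm ?_
      exact R.sameSide_of_le hxy (flip hux) (flip hvx) huy.1.symm hvy.1.symm h2 h3 (h3.trans h1)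
  · rcases le_total (R.ht u) (R.ht y) with h3 | h3
    · exact R.sameSide_of_le huv hux huy hvx.1 hvy.1 h1 (h3.trans h2) h3
    · refine SameSide.comm R.a_inj hux.1.symm hvx.1.symm huy.1.symm hvy.1.symm ?_
      exact (R.sameSide_of_le hxy.symm (flip huy) (flip hvy) hux.1.symm hvx.1.symm h2 h3
        (h3.trans h1)).swap
  · rcases le_total (R.ht v) (R.ht x) with h3 | h3
    · exact (R.sameSide_of_le huv.symm hvx hvy hux.1 huy.1 h1 h3 (h3.trans h2)).swap
    · refine SameSide.comm R.a_inj hux.1.symm hvx.1.symm huy.1.symm hvy.1.symm ?_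
      exact R.sameSide_of_le hxy (flip hux) (flip hvx) huy.1.symm hvy.1.symm h2 (h3.trans h1) h3
  · rcases le_total (R.ht v) (R.ht y) with h3 | h3
    · exact (R.sameSide_of_le huv.symm hvx hvy hux.1 huy.1 h1 (h3.trans h2) h3).swap
    · refine SameSide.comm R.a_inj hux.1.symm hvx.1.symm huy.1.symm hvy.1.symm ?_
      exact (R.sameSide_of_le hxy.symm (flip huy) (flip hvy) hux.1.symm hvx.1.symm h2
        (h3.trans h1) h3).swap

theorem sameSide_diagonals_of_le {w x y z : V} (hwx : G.Adj w x) (hwz : G.Adj w z)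
    (hwy : w ≠ y ∧ ¬ G.Adj w y) (hxy : x ≠ y) (hzy : z ≠ y)
    (hx : R.ht w ≤ R.ht x) (hy : R.ht w ≤ R.ht y) (hz : R.ht w ≤ R.ht z) :
    SameSide R.a w y x z := by
  have hx := hx.lt_of_ne (R.ht_inj.ne hwx.ne)
  have hy := hy.lt_of_ne (R.ht_inj.ne hwy.1)
  have hz := hz.lt_of_ne (R.ht_inj.ne hwz.ne)
  have h1 := R.outsideChord_of_not_adj hwx hwy.1 hxy hwy.2 hx hy
  have h2 := R.outsideChord_of_not_adj hwz hwy.1 hzy hwy.2 hz hy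
  have h3 := R.lt_iff_lt_of_adj hwx hwz hx hz
  have h4 := R.a_inj.ne hxy
  have h5 := R.a_inj.ne hzy
  unfold SameSide OutsideChord at *
  grind

/-- The two diagonals of an induced 4-cycle do not cross. -/
theorem sameSide_diagonals {w x y z : V} (hwx : G.Adj w x) (hxy : G.Adj x y) (hyz : G.Adj y z)
    (hzw : G.Adj z w) (hwy : w ≠ y ∧ ¬ G.Adj w y) (hxz : x ≠ z ∧ ¬ G.Adj x z) :
    SameSide R.a w y x z := by
  have hyw : y ≠ w ∧ ¬ G.Adj y w := ⟨hwy.1.symm, fun e => hwy.2 e.symm⟩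
  have hzx : z ≠ x ∧ ¬ G.Adj z x := ⟨hxz.1.symm, fun e => hxz.2 e.symm⟩
  have hcomm := SameSide.comm (f := R.a) R.a_inj hwx.symm.ne hxy.ne hzw.ne hyz.symm.ne
  rcases le_total (R.ht w) (R.ht y) with h1 | h1 <;>
  rcases le_total (R.ht x) (R.ht z) with h2 | h2
  · rcases le_total (R.ht w) (R.ht x) with h3 | h3
    · exact R.sameSide_diagonals_of_le hwx hzw.symm hwy hxy.ne hyz.symm.ne h3 h1 (h3.trans h2)
    · exact hcomm (R.sameSide_diagonals_of_le hwx.symm hxy hxz hzw.symm.ne hyz.ne h3 h2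
        (h3.trans h1))
  · rcases le_total (R.ht w) (R.ht z) with h3 | h3
    · exact R.sameSide_diagonals_of_le hwx hzw.symm hwy hxy.ne hyz.symm.ne (h3.trans h2) h1 h3
    · exact hcomm (R.sameSide_diagonals_of_le hzw hyz.symm hzx hwx.ne hxy.symm.ne h3 h2
        (h3.trans h1)).swap
  · rcases le_total (R.ht y) (R.ht x) with h3 | h3
    · exact (R.sameSide_diagonals_of_le hxy.symm hyz hyw hwx.symm.ne hzw.ne h3 h1
        (h3.trans h2)).swap
    · exact hcomm (R.sameSide_diagonals_of_le hwx.symm hxy hxz hzw.symm.ne hyz.ne (h3.trans h1)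
        h2 h3)
  · rcases le_total (R.ht y) (R.ht z) with h3 | h3
    · exact (R.sameSide_diagonals_of_le hxy.symm hyz hyw hwx.symm.ne hzw.ne (h3.trans h2) h1
        h3).swap
    · exact hcomm (R.sameSide_diagonals_of_le hzw hyz.symm hzx hwx.ne hxy.symm.ne (h3.trans h1)
        h2 h3).swap

/-- Two disjoint paths with no edge between them do not cross. -/
theorem sameSide_of_isChain {s x : V} {l m : List V} (hl : (s :: l).IsChain G.Adj)
    (hm : (x :: m).IsChain G.Adj)
    (h : ∀ p ∈ s :: l, ∀ q ∈ x :: m, p ≠ q ∧ ¬ G.Adj p q) :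
    SameSide R.a s ((s :: l).getLast (List.cons_ne_nil s l)) x
      ((x :: m).getLast (List.cons_ne_nil x m)) := by
  have hlast := List.getLast_mem (List.cons_ne_nil x m)
  have hne {p q : V} (hp : p ∈ s :: l) (hq : q ∈ x :: m) : p ≠ q := (h p hp q hq).1
  refine SameSide.comm R.a_inj (hne (by simp) (by simp)).symm
    (hne (List.getLast_mem _) (by simp)).symm (hne (by simp) hlast).symm
    (hne (List.getLast_mem _) hlast).symm ?_
  refine SameSide.of_isChain (List.isChain_iff_getElem.2 fun i hi => ?_)
  have hpl := List.getElem_mem (Nat.lt_of_succ_lt hi)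
  have hql := List.getElem_mem hi
  have hp := h _ hpl
  have hq := h _ hql
  refine SameSide.comm R.a_inj (hne hpl (by simp)) (hne hpl hlast) (hne hql (by simp))
    (hne hql hlast) ?_
  refine SameSide.of_isChain (List.isChain_iff_getElem.2 fun j hj => ?_)
  have hj' := Nat.lt_of_succ_lt hj
  exact R.sameSide_of_adj (hl.getElem i hi) (hm.getElem j hj) (hp _ (List.getElem_mem hj'))
    (hp _ (List.getElem_mem hj)) (hq _ (List.getElem_mem hj')) (hq _ (List.getElem_mem hj))

end GroundedLJRep

/-- Adjacency in `ringedSquare`. -/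
def ringedSquareEdges : List (Fin 12 × Fin 12) :=
  [(0, 1), (1, 2), (2, 3), (3, 0),
    (4, 5), (5, 6), (6, 7), (7, 8), (8, 9), (9, 10), (10, 11), (11, 4),
    (0, 4), (1, 6), (2, 8), (3, 10)]

/-- The 4-cycle on `0, …, 3` and the 8-cycle on `4, …, 11`, with the vertices of the former
joined by a matching to every other vertex of the latter, in cyclic order. -/
def ringedSquare : SimpleGraph (Fin 12) where
  Adj u v := (u, v) ∈ ringedSquareEdges ∨ (v, u) ∈ ringedSquareEdges
  symm := ⟨fun _ _ h => h.symm⟩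
  loopless := ⟨by decide⟩

instance : DecidableRel ringedSquare.Adj := fun u v =>
  inferInstanceAs (Decidable ((u, v) ∈ ringedSquareEdges ∨ (v, u) ∈ ringedSquareEdges))

/-- The non-crossing disjoint paths and diagonals determine which of the chords below cross: the
chord from `7` to `11` would both cross and avoid the chord from `0` to `2`. -/
theorem isEmpty_groundedLJRep_ringedSquare : IsEmpty (GroundedLJRep ringedSquare) := by
  refine ⟨fun R => ?_⟩
  have path (s x : Fin 12) (l m : List (Fin 12))
      (hl : (s :: l).IsChain ringedSquare.Adj := by decide)
      (hm : (x :: m).IsChain ringedSquare.Adj := by decide)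
      (h : ∀ p ∈ s :: l, ∀ q ∈ x :: m, p ≠ q ∧ ¬ ringedSquare.Adj p q := by decide) :=
    R.sameSide_of_isChain hl hm h
  have cross {s t x y : Fin 12} (h : SameSide R.a s t x y) (h' : SameSide R.a s x t y)
      (hd : [s, t, x, y].Nodup := by decide) : ¬ SameSide R.a x t s y :=
    h.not_sameSide R.a_inj hd h'
  have uncross {s t x y : Fin 12} (h : ¬ SameSide R.a s t x y)
      (hd : [s, t, x, y].Nodup := by decide) : SameSide R.a x s y t :=
    SameSide.of_not_sameSide R.a_inj hd h
  have comm {s t x y : Fin 12} (h : SameSide R.a s t x y)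
      (hd : s ≠ x ∧ s ≠ y ∧ t ≠ x ∧ t ≠ y := by decide) : SameSide R.a x y s t :=
    h.comm R.a_inj hd.1 hd.2.1 hd.2.2.1 hd.2.2.2
  have h47_13 : ¬ SameSide R.a 4 7 1 3 := fun h =>
    cross (path 1 4 [6, 7] [11, 10]) (path 1 7 [0, 4] [8, 9, 10]) (by decide)
      (h.trans (path 4 3 [5, 6, 7] [10]))
  have h47_23 : SameSide R.a 4 7 2 3 := path 4 2 [5, 6, 7] [3]
  have h12_47 : ¬ SameSide R.a 1 2 4 7 := fun h => h47_13 ((comm h).trans h47_23)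
  have h7_11_01 : SameSide R.a 7 11 0 1 := path 7 0 [8, 9, 10, 11] [1]
  have h7_11_02 : ¬ SameSide R.a 7 11 0 2 := fun h =>
    h12_47 ((path 1 4 [2] [11]).trans (comm (h7_11_01.symm.trans h)).symm)
  have h7_11_23 : SameSide R.a 7 11 2 3 := comm ((comm h47_23).symm.trans (path 2 4 [3] [11]))
  have h9_11_03 : ¬ SameSide R.a 9 11 0 3 := fun h =>
    h7_11_02 ((comm ((path 0 7 [3] [8, 9]).trans (comm h))).trans h7_11_23.symm)
  have h9_11_23 : ¬ SameSide R.a 9 11 2 3 := fun h => h9_11_03 ((path 9 0 [10, 11] [1, 2]).trans h)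
  have h02_3_11 : SameSide R.a 0 2 3 11 :=
    comm ((comm (uncross h9_11_03)).trans (comm (uncross h9_11_23)).symm)
  have h57_12 : ¬ SameSide R.a 5 7 1 2 := fun h => h12_47 ((path 1 4 [2] [5]).trans (comm h))
  have h57_10 : ¬ SameSide R.a 5 7 1 0 := fun h =>
    h57_12 ((h.trans (path 5 0 [6, 7] [3])).trans (path 5 2 [6, 7] [3]).symm)
  have h02_17 : SameSide R.a 0 2 1 7 :=
    comm ((uncross fun h => h57_10 h.swap).trans (uncross fun h => h57_12 h.swap).symm)
  have h02_13 : SameSide R.a 0 2 1 3 := by apply R.sameSide_diagonals <;> decide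
  exact h7_11_02 (comm ((h02_17.symm.trans h02_13).trans h02_3_11))

/-- The value at `(x, y)` of a linear equation of the line supporting `GSeg a b c`. -/
def segLine {R : Type*} [Ring R] (a b c x y : R) : R :=
  c * (x - a) + (b - a) * y

theorem mem_GSeg_iff {a b c : ℝ} {p : ℝ × ℝ} :
    p ∈ GSeg a b c ↔ ∃ t ∈ Set.Icc (0 : ℝ) 1, p = (a + t * (b - a), -(t * c)) := by
  rw [GSeg, segment_eq_image']
  simp [Set.mem_image, eq_comm]

theorem segLine_eq_zero_of_mem {a b c : ℝ} {p : ℝ × ℝ} (hp : p ∈ GSeg a b c) :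
    segLine a b c p.1 p.2 = 0 := by
  obtain ⟨t, -, rfl⟩ := mem_GSeg_iff.1 hp
  simp only [segLine]
  ring

theorem segLine_param (a b c a' b' c' t : ℝ) :
    segLine a b c (a' + t * (b' - a')) (-(t * c')) =
      (1 - t) * segLine a b c a' 0 + t * segLine a b c b' (-c') := by
  simp only [segLine]
  ring

theorem GSeg_inter_subsingleton {a b c a' b' c' : ℝ} (h : segLine a b c a' 0 ≠ 0) :
    (GSeg a b c ∩ GSeg a' b' c').Subsingleton := by
  rintro p ⟨hp, hp'⟩ q ⟨hq, hq'⟩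
  have h1 := segLine_eq_zero_of_mem hp
  have h2 := segLine_eq_zero_of_mem hq
  obtain ⟨t, -, rfl⟩ := mem_GSeg_iff.1 hp'
  obtain ⟨u, -, rfl⟩ := mem_GSeg_iff.1 hq'
  simp only [segLine_param] at h1 h2
  have htu : (t - u) * segLine a b c a' 0 = 0 := by linear_combination t * h2 - u * h1
  rw [sub_eq_zero.1 ((mul_eq_zero.1 htu).resolve_right h)]

theorem mul_neg_of_inter_nonempty {a b c a' b' c' : ℝ} (h : segLine a b c a' 0 ≠ 0)
    (h' : segLine a b c b' (-c') ≠ 0) (hne : (GSeg a b c ∩ GSeg a' b' c').Nonempty) :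
    segLine a b c a' 0 * segLine a b c b' (-c') < 0 := by
  obtain ⟨p, hp, hp'⟩ := hne
  have h1 := segLine_eq_zero_of_mem hp
  obtain ⟨t, ⟨ht0, ht1⟩, rfl⟩ := mem_GSeg_iff.1 hp'
  simp only [segLine_param] at h1
  by_contra! hpos
  have hpos := lt_of_le_of_ne hpos (mul_ne_zero h h').symm
  set A := segLine a b c a' 0
  set B := segLine a b c b' (-c')
  have hA : (1 - t) * A ^ 2 + t * (A * B) = 0 := by linear_combination A * h1
  have hA2 : 0 < A ^ 2 := by positivity
  rcases ht0.eq_or_lt with rfl | ht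
  · linarith
  · nlinarith [mul_pos ht hpos, mul_nonneg (sub_nonneg.2 ht1) hA2.le]

theorem inter_nonempty_of_mul_neg {a b c a' b' c' : ℝ} (hc : 0 < c) (hc' : 0 < c')
    (h : segLine a b c a' 0 * segLine a b c b' (-c') < 0)
    (h' : segLine a' b' c' a 0 * segLine a' b' c' b (-c) < 0) :
    (GSeg a b c ∩ GSeg a' b' c').Nonempty := by
  set A := segLine a b c a' 0 with hA
  set B := segLine a b c b' (-c') with hB
  have hAB : A - B ≠ 0 := by
    intro e
    rw [sub_eq_zero.1 e] at h
    nlinarith [mul_self_nonneg B]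
  have hsq : 0 < (A - B) ^ 2 := by positivity
  have hu0 : 0 ≤ A / (A - B) := by
    rw [show A / (A - B) = (A ^ 2 - A * B) / (A - B) ^ 2 by field_simp]
    exact div_nonneg (by nlinarith [sq_nonneg A]) hsq.le
  have hu1 : A / (A - B) ≤ 1 := by
    rw [show A / (A - B) = 1 - (B ^ 2 - A * B) / (A - B) ^ 2 by field_simp; ring]
    have : 0 ≤ (B ^ 2 - A * B) / (A - B) ^ 2 := div_nonneg (by nlinarith [sq_nonneg B]) hsq.le
    linarith
  set u := A / (A - B) with hu
  have hzero : (1 - u) * A + u * B = 0 := by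
    rw [hu]
    field_simp
    ring
  have hx : c * (a' + u * (b' - a') - a) = (b - a) * (u * c') := by
    have := segLine_param a b c a' b' c' u
    rw [← hA, ← hB, hzero, segLine] at this
    linarith
  set t := u * c' / c with ht
  have htc : t * c = u * c' := by rw [ht]; field_simp
  have hxt : a' + u * (b' - a') = a + t * (b - a) := by
    have : c * (a' + u * (b' - a') - (a + t * (b - a))) = 0 := by
      linear_combination hx - (b - a) * htc
    linarith [(mul_eq_zero.1 this).resolve_left hc.ne']
  refine ⟨(a' + u * (b' - a'), -(u * c')), mem_GSeg_iff.2 ⟨t, ⟨by positivity, ?_⟩, ?_⟩,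
    mem_GSeg_iff.2 ⟨u, ⟨hu0, hu1⟩, rfl⟩⟩
  · have h1 := segLine_param a' b' c' a b c t
    have h2 : segLine a' b' c' (a + t * (b - a)) (-(t * c)) = 0 := by
      rw [← hxt, htc, segLine]
      ring
    rw [h2] at h1
    by_contra! ht1
    set A' := segLine a' b' c' a 0
    set B' := segLine a' b' c' b (-c)
    have : t * B' ^ 2 = (t - 1) * (A' * B') := by linear_combination -B' * h1
    nlinarith [mul_pos (sub_pos.2 ht1) (neg_pos.2 h'), sq_nonneg B']
  · rw [hxt, htc]

/-- A grounded segment representation from integer data in general position. -/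
def GroundedSegRep.ofInt {V : Type} {G : SimpleGraph V} (a b c : V → ℤ) (hc : ∀ v, 0 < c v)
    (hgen : ∀ u v, u ≠ v → segLine (a u) (b u) (c u) (a v) 0 ≠ 0 ∧
      segLine (a u) (b u) (c u) (b v) (-c v) ≠ 0)
    (hadj : ∀ u v, u ≠ v → (G.Adj u v ↔
      segLine (a u) (b u) (c u) (a v) 0 * segLine (a u) (b u) (c u) (b v) (-c v) < 0 ∧
      segLine (a v) (b v) (c v) (a u) 0 * segLine (a v) (b v) (c v) (b u) (-c u) < 0)) :
    GroundedSegRep G :=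
  have cast (u : V) (x y : ℤ) : segLine (a u : ℝ) (b u) (c u) x y =
      (segLine (a u) (b u) (c u) x y : ℤ) := by
    simp [segLine]
  have hgen' (u v : V) (huv : u ≠ v) : segLine (a u : ℝ) (b u) (c u) (a v) 0 ≠ 0 ∧
      segLine (a u : ℝ) (b u) (c u) (b v) (-c v) ≠ 0 := by
    have := hgen u v huv
    exact_mod_cast And.intro ((cast u (a v) 0).trans_ne (Int.cast_ne_zero.2 this.1))
      ((cast u (b v) (-c v)).trans_ne (Int.cast_ne_zero.2 this.2))
  have hc' (v : V) : (0 : ℝ) < c v := Int.cast_pos.2 (hc v)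
  { a := fun v => a v
    b := fun v => b v
    c := fun v => c v
    c_pos := hc'
    a_inj := fun u v h => by
      by_contra huv
      exact (hgen' u v huv).1 (by simp only at h; simp [segLine, h])
    inter_finite := fun u v huv => (GSeg_inter_subsingleton (hgen' u v huv).1).finite
    endpoints_off := fun u v huv =>
      ⟨fun h => (hgen' u v huv).1 (segLine_eq_zero_of_mem h),
        fun h => (hgen' u v huv).2 (segLine_eq_zero_of_mem h)⟩
    adj_iff := fun u v huv => by
      have h1 := hgen' u v huv
      have h2 := hgen' v u huv.symm
      have key : G.Adj u v ↔
          segLine (a u : ℝ) (b u) (c u) (a v) 0 * segLine (a u : ℝ) (b u) (c u) (b v) (-c v) < 0 ∧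
          segLine (a v : ℝ) (b v) (c v) (a u) 0 *
            segLine (a v : ℝ) (b v) (c v) (b u) (-c u) < 0 := by
        rw [hadj u v huv]
        have e1 := cast u (a v) 0
        have e2 := cast u (b v) (-c v)
        have e3 := cast v (a u) 0
        have e4 := cast v (b u) (-c u)
        push_cast at e1 e2 e3 e4
        rw [e1, e2, e3, e4]
        norm_cast
      rw [key]
      refine ⟨fun h => inter_nonempty_of_mul_neg (hc' u) (hc' v) h.1 h.2, fun h => ⟨?_, ?_⟩⟩
      · exact mul_neg_of_inter_nonempty h1.1 h1.2 h
      · exact mul_neg_of_inter_nonempty h2.1 h2.2 (Set.inter_comm _ _ ▸ h) }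

theorem nonempty_groundedSegRep_ringedSquare : Nonempty (GroundedSegRep ringedSquare) :=
  ⟨.ofInt
    ![100, 4200, 24600, 28000, 150, 2000, 1900, 6000, 5990, 26000, 25995, 40000]
    ![29200, 31000, 31000, 19000, 21100, 145, 6020, 5940, 26020, 25970, 40200, 19000]
    ![1030000, 1322000, 1420000, 690000, 6285000, 502, 4120, 6000, 2003, 5000, 140, 6300000]
    (by decide) (by decide) (by decide)⟩

/-- Some finite simple graph admits a grounded segment
representation but no grounded {L,J}-representation. -/
theorem exists_groundedSeg_not_groundedLJ :
    ∃ (n : ℕ) (G : SimpleGraph (Fin n)),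
      Nonempty (GroundedSegRep G) ∧ IsEmpty (GroundedLJRep G) := by
  exact ⟨12, ringedSquare, nonempty_groundedSegRep_ringedSquare,
    isEmpty_groundedLJRep_ringedSquare⟩
end

section
/- Let G be the simple graph on vertex set {1,2,3,4} whose edges are exactly {1,2}, {2,3} and {1,4}. Then G admits a grounded {L,J}-representation inducing the order 1 < 2 < 3 < 4 (ordering vertices by their anchors), but G admits no grounded L-representation inducing the order 1 < 2 < 3 < 4. -/
/-- The graph on vertices `0, 1, 2, 3` (standing for `x₁, x₂, x₃, x₄`) with
edges exactly `x₁x₂`, `x₂x₃`, `x₁x₄`. -/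
def G1234 : SimpleGraph (Fin 4) :=
  SimpleGraph.fromEdgeSet {s((0 : Fin 4), (1 : Fin 4)), s((1 : Fin 4), (2 : Fin 4)),
    s((0 : Fin 4), (3 : Fin 4))}

theorem segment_prodMk_left (x b c : ℝ) (p : ℝ × ℝ) (hbc : c ≤ b) :
    p ∈ segment ℝ ((x, b) : ℝ × ℝ) (x, c) ↔ p.1 = x ∧ c ≤ p.2 ∧ p.2 ≤ b := by
  obtain ⟨p, q⟩ := p
  rw [← Prod.image_mk_segment_right, segment_symm, segment_eq_Icc hbc]
  simp only [Set.mem_image, Set.mem_Icc, Prod.mk.injEq]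
  grind

theorem segment_prodMk_right (y b c : ℝ) (p : ℝ × ℝ) (hbc : b ≤ c) :
    p ∈ segment ℝ ((b, y) : ℝ × ℝ) (c, y) ↔ p.2 = y ∧ b ≤ p.1 ∧ p.1 ≤ c := by
  obtain ⟨p, q⟩ := p
  rw [← Prod.image_mk_segment_left, segment_eq_Icc hbc]
  simp only [Set.mem_image, Set.mem_Icc, Prod.mk.injEq]
  grind

theorem mem_LShape {a h w : ℝ} (hh : 0 < h) (hw : 0 < w) (p : ℝ × ℝ) :
    p ∈ LShape a h w ↔
      (p.1 = a ∧ -h ≤ p.2 ∧ p.2 ≤ 0) ∨ (p.2 = -h ∧ a ≤ p.1 ∧ p.1 ≤ a + w) := by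
  rw [LShape, Set.mem_union, segment_prodMk_left _ _ _ _ (by linarith),
    segment_prodMk_right _ _ _ _ (by linarith)]

theorem mem_JShape {a h w : ℝ} (hh : 0 < h) (hw : 0 < w) (p : ℝ × ℝ) :
    p ∈ JShape a h w ↔
      (p.1 = a ∧ -h ≤ p.2 ∧ p.2 ≤ 0) ∨ (p.2 = -h ∧ a - w ≤ p.1 ∧ p.1 ≤ a) := by
  rw [JShape, Set.mem_union, segment_prodMk_left _ _ _ _ (by linarith),
    segment_prodMk_right _ _ _ _ (by linarith)]

theorem LShape_inter_nonempty_iff {a h w a' h' w' : ℝ} (hh : 0 < h) (hw : 0 < w)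
    (hh' : 0 < h') (hw' : 0 < w') (ha : a < a') (hne : h ≠ h') :
    (LShape a h w ∩ LShape a' h' w').Nonempty ↔ h < h' ∧ a' ≤ a + w := by
  constructor
  · rintro ⟨p, hp, hp'⟩
    rw [mem_LShape hh hw] at hp
    rw [mem_LShape hh' hw'] at hp'
    grind
  · rintro ⟨h1, h2⟩
    refine ⟨(a', -h), ?_, ?_⟩
    · rw [mem_LShape hh hw]
      exact Or.inr ⟨rfl, ha.le, h2⟩
    · rw [mem_LShape hh' hw']
      exact Or.inl ⟨rfl, by simpa using h1.le, by simpa using hh.le⟩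

theorem mem_LJShape {b : Bool} {a h w : ℝ} (hh : 0 < h) (hw : 0 < w) (p : ℝ × ℝ) :
    p ∈ LJShape b a h w ↔
      (p.1 = a ∧ -h ≤ p.2 ∧ p.2 ≤ 0) ∨
      (p.2 = -h ∧ (if b then a else a - w) ≤ p.1 ∧ p.1 ≤ if b then a + w else a) := by
  cases b
  · simpa [LJShape] using mem_JShape hh hw p
  · simpa [LJShape] using mem_LShape hh hw p

/-- A grounded {L,J}-representation of `G1234` in which only the third vertex is a J-shape. -/
noncomputable def G1234LJRep : GroundedLJRep G1234 where
  a := ![1, 2, 3, 4]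
  ht := ![2, 3, 1, 4]
  wd := ![7 / 2, 1 / 2, 3 / 2, 1]
  isL := ![true, true, false, true]
  ht_pos v := by fin_cases v <;> norm_num
  wd_pos v := by fin_cases v <;> norm_num
  a_inj u v := by fin_cases u <;> fin_cases v <;> norm_num
  ht_inj u v := by fin_cases u <;> fin_cases v <;> norm_num
  endpoint_off u v huv := by
    rw [mem_LJShape (by fin_cases u <;> norm_num) (by fin_cases u <;> norm_num)]
    fin_cases u <;> fin_cases v <;> first | exact absurd rfl huv | norm_num [LJEnd]
  adj_iff u v huv := by
    have key : ∀ p : ℝ × ℝ, _ ↔ _ := fun p ↦ and_congr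
      (mem_LJShape (b := ![true, true, false, true] u) (a := ![1, 2, 3, 4] u)
        (h := ![2, 3, 1, 4] u) (w := ![7 / 2, 1 / 2, 3 / 2, 1] u)
        (by fin_cases u <;> norm_num) (by fin_cases u <;> norm_num) p)
      (mem_LJShape (b := ![true, true, false, true] v) (a := ![1, 2, 3, 4] v)
        (h := ![2, 3, 1, 4] v) (w := ![7 / 2, 1 / 2, 3 / 2, 1] v)
        (by fin_cases v <;> norm_num) (by fin_cases v <;> norm_num) p)
    simp only [Set.Nonempty, Set.mem_inter_iff, key]
    fin_cases u <;> fin_cases v <;> simp [G1234] at huv ⊢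
    all_goals first
      | (refine ⟨2, -2, ?_⟩; norm_num; done)
      | (refine ⟨2, -1, ?_⟩; norm_num; done)
      | (refine ⟨4, -2, ?_⟩; norm_num)
      | grind

/-- The graph with edges `x₁x₂`, `x₂x₃`, `x₁x₄` admits a grounded
{L,J}-representation inducing the order `x₁ < x₂ < x₃ < x₄`, but no grounded
L-representation inducing that order. -/
theorem G1234_LJ_order_but_not_L_order :
    (∃ R : GroundedLJRep G1234, ∀ i j : Fin 4, i < j ↔ R.a i < R.a j) ∧
    ¬ (∃ R : GroundedLRep G1234, ∀ i j : Fin 4, i < j ↔ R.a i < R.a j) := by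
  refine ⟨⟨G1234LJRep, fun i j ↦ ?_⟩, ?_⟩
  · fin_cases i <;> fin_cases j <;> norm_num [G1234LJRep, Fin.lt_def]
  · rintro ⟨R, hR⟩
    have key (u v : Fin 4) (huv : u < v) :
        G1234.Adj u v ↔ R.ht u < R.ht v ∧ R.a v ≤ R.a u + R.wd u := by
      rw [R.adj_iff u v huv.ne, LShape_inter_nonempty_iff (R.ht_pos u) (R.wd_pos u) (R.ht_pos v)
        (R.wd_pos v) ((hR u v).1 huv) (R.ht_inj.ne huv.ne)]
    have h01 := (key 0 1 (by decide)).1 (by simp [G1234])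
    have h12 := (key 1 2 (by decide)).1 (by simp [G1234])
    have h03 := (key 0 3 (by decide)).1 (by simp [G1234])
    have h23 := (hR 2 3).1 (by decide)
    have h02 := (key 0 2 (by decide)).2 ⟨h01.1.trans h12.1, h23.le.trans h03.2⟩
    simp [G1234] at h02
end

section
/- A finite simple graph G is a permutation graph (i.e., there exist injective functions f, g : V → ℝ such that distinct vertices u and v are adjacent in G iff (f u − f v)·(g u − g v) < 0) if and only if G admits a grounded L-representation in which all right endpoints lie on a common vertical line, i.e., the value a v + w v is the same for every vertex v. -/
theorem mem_LShape_iff {a h w : ℝ} (hh : 0 ≤ h) (hw : 0 ≤ w) {x y : ℝ} :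
    (x, y) ∈ LShape a h w ↔
      (x = a ∧ -h ≤ y ∧ y ≤ 0) ∨ (a ≤ x ∧ x ≤ a + w ∧ y = -h) := by
  rw [LShape, ← Prod.image_mk_segment_right, ← Prod.image_mk_segment_left, segment_symm,
    segment_eq_Icc (by linarith), segment_eq_Icc (by linarith)]
  simp only [Set.mem_union, Set.mem_image, Set.mem_Icc, Prod.mk.injEq]
  grind

/-- If the second anchor lies above the horizontal arm of the first shape, the shapes meet
exactly when the horizontal arm of the first reaches the vertical arm of the second. -/
theorem LShape_inter_nonempty_iff_s15 {a h w b k z : ℝ} (hh : 0 ≤ h) (hw : 0 ≤ w) (hk : 0 ≤ k)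
    (hz : 0 ≤ z) (hab : a < b) (hb : b ≤ a + w) :
    (LShape a h w ∩ LShape b k z).Nonempty ↔ h ≤ k := by
  constructor
  · rintro ⟨⟨x, y⟩, hx, hy⟩
    rw [mem_LShape_iff hh hw] at hx
    rw [mem_LShape_iff hk hz] at hy
    grind
  · intro hle
    refine ⟨(b, -h), (mem_LShape_iff hh hw).2 (Or.inr ⟨hab.le, hb, rfl⟩),
      (mem_LShape_iff hk hz).2 (Or.inl ⟨rfl, ?_, ?_⟩)⟩ <;> linarith

/-- Two grounded L-shapes with a common right end and distinct anchors and depths meet exactly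
when anchors and depths are ordered in the same way. -/
theorem LShape_inter_nonempty_iff_mul_pos {a h w b k z : ℝ} (hh : 0 < h) (hw : 0 < w)
    (hk : 0 < k) (hz : 0 < z) (hab : a ≠ b) (hhk : h ≠ k) (he : a + w = b + z) :
    (LShape a h w ∩ LShape b k z).Nonempty ↔ 0 < (a - b) * (h - k) := by
  rcases hab.lt_or_gt with hlt | hlt
  · rw [LShape_inter_nonempty_iff_s15 hh.le hw.le hk.le hz.le hlt (by linarith),
      ← neg_mul_neg, neg_sub, neg_sub, mul_pos_iff_of_pos_left (sub_pos.2 hlt), sub_pos,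
      hhk.le_iff_lt]
  · rw [Set.inter_comm,
      LShape_inter_nonempty_iff_s15 hk.le hz.le hh.le hw.le hlt (by linarith),
      mul_pos_iff_of_pos_left (sub_pos.2 hlt), sub_pos, hhk.symm.le_iff_lt]

theorem endpoint_notMem_LShape {a h w b k z : ℝ} (hh : 0 < h) (hw : 0 < w) (hhk : h ≠ k)
    (he : a + w = b + z) : (b + z, -k) ∉ LShape a h w := by
  rw [mem_LShape_iff hh.le hw.le]
  grind

theorem exp_neg_sub_mul_pos_iff (x y s t : ℝ) :
    0 < (-Real.exp (-x) - -Real.exp (-y)) * (Real.exp (-s) - Real.exp (-t)) ↔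
      (x - y) * (s - t) < 0 := by
  simp only [mul_pos_iff, mul_neg_iff, sub_pos, sub_neg, neg_lt_neg_iff, Real.exp_lt_exp]

/-- A finite simple graph is a permutation graph iff it admits a
grounded L-representation in which all right endpoints lie on a common vertical
line, i.e. `a v + w v` is constant. -/
theorem permutation_iff_groundedL_common_right_end {V : Type} [Fintype V]
    (G : SimpleGraph V) :
    (∃ f g : V → ℝ, Function.Injective f ∧ Function.Injective g ∧
      ∀ u v : V, u ≠ v → (G.Adj u v ↔ (f u - f v) * (g u - g v) < 0)) ↔
    (∃ R : GroundedLRep G, ∀ u v : V, R.a u + R.wd u = R.a v + R.wd v) := by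
  constructor
  · rintro ⟨f, g, hf, hg, hadj⟩
    have exp_neg_inj : Function.Injective fun x : ℝ => Real.exp (-x) :=
      Real.exp_injective.comp neg_injective
    refine ⟨{ a := fun v => -Real.exp (-f v)
              ht := fun v => Real.exp (-g v)
              wd := fun v => Real.exp (-f v)
              ht_pos := fun v => Real.exp_pos _
              wd_pos := fun v => Real.exp_pos _
              a_inj := neg_injective.comp (exp_neg_inj.comp hf)
              ht_inj := exp_neg_inj.comp hg
              endpoint_off := ?_
              adj_iff := ?_ }, by simp⟩
    · intro u v huv
      exact endpoint_notMem_LShape (Real.exp_pos _) (Real.exp_pos _)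
        ((exp_neg_inj.comp hg).ne huv) (by simp)
    · intro u v huv
      rw [hadj u v huv, ← exp_neg_sub_mul_pos_iff]
      exact (LShape_inter_nonempty_iff_mul_pos (Real.exp_pos _) (Real.exp_pos _)
        (Real.exp_pos _) (Real.exp_pos _) ((neg_injective.comp (exp_neg_inj.comp hf)).ne huv)
        ((exp_neg_inj.comp hg).ne huv) (by simp)).symm
  · rintro ⟨R, hR⟩
    refine ⟨R.a, fun v => -R.ht v, R.a_inj, neg_injective.comp R.ht_inj, fun u v huv => ?_⟩
    rw [R.adj_iff u v huv, LShape_inter_nonempty_iff_mul_pos (R.ht_pos u) (R.wd_pos u)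
      (R.ht_pos v) (R.wd_pos v) (R.a_inj.ne huv) (R.ht_inj.ne huv) (hR u v), ← neg_lt_zero]
    ring_nf
end
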